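/- arXiv:2112.01327 — 3 statements merged into one kernel-verified Lean document; each statement's English description precedes it below -/
import Mathlib

section
/- Let γ > 0 and let (θ_k) be the sequence defined by θ_0 = 1 and θ_{k+1} equal to the unique positive root of θ² = (1 + θ)·θ_k² + γ·θ. Then for every k, θ_{k+1} > θ_k² + γ; in particular θ_k ≥ 1 for all k and the sequence (θ_k) is strictly increasing from index 1 onward. -/
/-- Let `γ > 0` and let `(θ k)` be the sequence defined by `θ 0 = 1` and `θ (k+1)`
the unique positive root of `θ² = (1 + θ)·(θ k)² + γ·θ`. Then for every `k`,
`θ (k+1) > (θ k)² + γ`; in particular `θ k ≥ 1` for all `k` and the sequence is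
strictly increasing from index `1` onward. -/
theorem theta_seq_properties (γ : ℝ) (hγ : 0 < γ) (θ : ℕ → ℝ)
    (h0 : θ 0 = 1)
    (hpos : ∀ k, 0 < θ (k + 1))
    (hrec : ∀ k, (θ (k + 1)) ^ 2 = (1 + θ (k + 1)) * (θ k) ^ 2 + γ * θ (k + 1)) :
    (∀ k, θ (k + 1) > (θ k) ^ 2 + γ) ∧ (∀ k, 1 ≤ θ k) ∧
      (∀ k, 1 ≤ k → θ k < θ (k + 1)) := by
  have hθ : ∀ k, 0 < θ k
    | 0 => h0 ▸ one_pos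
    | k + 1 => hpos k
  have hgt : ∀ k, θ (k + 1) > θ k ^ 2 + γ := fun k => by
    have hmul : 0 < θ (k + 1) * (θ (k + 1) - (θ k ^ 2 + γ)) := by
      linear_combination pow_pos (hθ k) 2 - hrec k
    exact sub_pos.mp (pos_of_mul_pos_right hmul (hpos k).le)
  have hone : ∀ k, 1 ≤ θ k := fun k => by
    induction k with
    | zero => exact h0.ge
    | succ k ih => nlinarith [hgt k]
  exact ⟨hgt, hone, fun k _ => by nlinarith [hgt k, hone k]⟩
end

section
/- Let γ > 0 and let (θ_k) be the sequence defined by θ_0 = 1 and θ_{k+1} equal to the unique positive root of θ² = (1 + θ)·θ_k² + γ·θ. Then θ_k tends to infinity as k → ∞. -/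
/-- Let `γ > 0` and let `(θ k)` be the sequence defined by `θ 0 = 1` and `θ (k+1)`
the unique positive root of `θ² = (1 + θ)·(θ k)² + γ·θ`. Then `θ k → ∞` as `k → ∞`. -/
theorem theta_seq_tendsto_atTop (γ : ℝ) (hγ : 0 < γ) (θ : ℕ → ℝ)
    (h0 : θ 0 = 1)
    (hpos : ∀ k, 0 < θ (k + 1))
    (hrec : ∀ k, (θ (k + 1)) ^ 2 = (1 + θ (k + 1)) * (θ k) ^ 2 + γ * θ (k + 1)) :
    Filter.Tendsto θ Filter.atTop Filter.atTop := by
  have sq_add_le (k : ℕ) : (θ k) ^ 2 + γ ≤ θ (k + 1) := by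
    refine le_of_mul_le_mul_right ?_ (hpos k)
    nlinarith [hrec k, sq_nonneg (θ k)]
  have lower_bound (k : ℕ) : 1 + k * γ ≤ θ k := by
    induction k with
    | zero => simp [h0]
    | succ k ih =>
      have hk : 0 ≤ k * γ := by positivity
      push_cast
      nlinarith [sq_add_le k]
  exact Filter.tendsto_atTop_mono lower_bound <|
    Filter.tendsto_atTop_add_const_left _ _ <|
      tendsto_natCast_atTop_atTop.atTop_mul_const hγ
end

section
/- Let γ > 0, let (θ_k) be the sequence defined by θ_0 = 1 and θ_{k+1} equal to the unique positive root of θ² = (1 + θ)·θ_k² + γ·θ, and define the momentum coefficients μ_k = θ_k(1 − θ_k)/(θ_k² + θ_{k+1}). Then every μ_k lies in the interval (−1, 0]; in particular |μ_k| < 1 for all k, and μ_0 = 0. -/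
/-- Let `γ > 0`, let `(θ k)` be the sequence defined by `θ 0 = 1` and `θ (k+1)` the
unique positive root of `θ² = (1 + θ)·(θ k)² + γ·θ`, and define the momentum
coefficients `μ k = θ k (1 − θ k)/((θ k)² + θ (k+1))`. Then every `μ k` lies in
`(−1, 0]`; in particular `|μ k| < 1` for all `k`, and `μ 0 = 0`. -/
theorem mu_seq_properties (γ : ℝ) (hγ : 0 < γ) (θ : ℕ → ℝ) (μ : ℕ → ℝ)
    (h0 : θ 0 = 1)
    (hpos : ∀ k, 0 < θ (k + 1))
    (hrec : ∀ k, (θ (k + 1)) ^ 2 = (1 + θ (k + 1)) * (θ k) ^ 2 + γ * θ (k + 1))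
    (hμ : ∀ k, μ k = θ k * (1 - θ k) / ((θ k) ^ 2 + θ (k + 1))) :
    (∀ k, -1 < μ k ∧ μ k ≤ 0) ∧ (∀ k, |μ k| < 1) ∧ μ 0 = 0 := by
  have one_le : ∀ k, 1 ≤ θ k := by
    intro k
    induction k with
    | zero => exact h0.ge
    | succ k ih =>
      have hp := hpos k
      have hθ : (θ k) ^ 2 ≤ (θ (k + 1)) ^ 2 := by
        rw [hrec k]
        nlinarith [mul_nonneg hp.le (sq_nonneg (θ k)), mul_pos hγ hp]
      exact ih.trans (abs_le_of_sq_le_sq' hθ hp.le).2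
  have bounds : ∀ k, -1 < μ k ∧ μ k ≤ 0 := by
    intro k
    have h1 := one_le k
    have hp := hpos k
    have hden : 0 < (θ k) ^ 2 + θ (k + 1) := by positivity
    rw [hμ k, lt_div_iff₀ hden]
    refine ⟨by nlinarith, div_nonpos_of_nonpos_of_nonneg ?_ hden.le⟩
    exact mul_nonpos_of_nonneg_of_nonpos (by linarith) (by linarith)
  refine ⟨bounds, fun k => abs_lt.2 ⟨(bounds k).1, (bounds k).2.trans_lt one_pos⟩, ?_⟩
  simp [hμ 0, h0]
end
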